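/- Let t ≥ r ≥ 3 and let H be a finite complete r-partite r-uniform hypergraph (all parts nonempty) with a spanning edge-coloring using r+t colors such that the vertex set of H cannot be covered by t+1 or fewer monochromatic components. Then for any two vertices u and v belonging to different parts of H, the number of colors c for which u and v lie in different monochromatic components of color c is at most t+1. -/

import Mathlib

/-- An edge of the complete r-partite r-uniform hypergraph with part assignment `p`
is a transversal: a choice of one vertex from each part. -/
def IsTransversal {V : Type*} {r : ℕ} (p : V → Fin r) (e : Fin r → V) : Prop :=
  ∀ i, p (e i) = i

/-- `u` and `v` lie in the same monochromatic component of color `c`: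
they are joined by a (possibly empty) sequence of edges of color `c`
in which consecutive edges intersect. -/
def SameComp {V : Type*} {r k : ℕ} (p : V → Fin r) (χ : (Fin r → V) → Fin k)
    (c : Fin k) (u v : V) : Prop :=
  Relation.ReflTransGen
    (fun a b => ∃ e, IsTransversal p e ∧ χ e = c ∧ (∃ i, e i = a) ∧ (∃ j, e j = b)) u v

/-- The coloring is spanning: every vertex is contained in an edge of every color. -/
def SpanningColoring {V : Type*} {r k : ℕ} (p : V → Fin r)
    (χ : (Fin r → V) → Fin k) : Prop :=
  ∀ (v : V) (c : Fin k), ∃ e, IsTransversal p e ∧ χ e = c ∧ ∃ i, e i = v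

/-- The vertex set can be covered by at most `m` monochromatic components;
a component is recorded as a pair (color, representative vertex). -/
def CoveredByComponents {V : Type*} {r k : ℕ} (p : V → Fin r)
    (χ : (Fin r → V) → Fin k) (m : ℕ) : Prop :=
  ∃ S : Finset (Fin k × V), S.card ≤ m ∧
    ∀ u : V, ∃ q ∈ S, SameComp p χ q.1 u q.2

theorem sameComp_symm_aux {V : Type*} {r k : ℕ} {p : V → Fin r} {χ : (Fin r → V) → Fin k}
    {c : Fin k} {u v : V} (h : SameComp p χ c u v) : SameComp p χ c v u := by
  unfold SameComp at h ⊢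
  induction h with
  | refl => exact Relation.ReflTransGen.refl
  | tail _ h2 ih =>
    obtain ⟨e, h1, h2, h3, h4⟩ := h2
    exact Relation.ReflTransGen.head ⟨e, h1, h2, h4, h3⟩ ih

theorem sameComp_edge_aux {V : Type*} {r k : ℕ} {p : V → Fin r} {χ : (Fin r → V) → Fin k}
    {e : Fin r → V} (he : IsTransversal p e) (i j : Fin r) :
    SameComp p χ (χ e) (e i) (e j) :=
  Relation.ReflTransGen.single ⟨e, he, rfl, ⟨i, rfl⟩, ⟨j, rfl⟩⟩

/-- If V(H) cannot be covered by t+1 monochromatic components, then vertices in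
different parts differ in at most t+1 colors. -/
theorem claim_small_distance (r t : ℕ) (hr : 3 ≤ r) (hrt : r ≤ t)
    (V : Type*) [Fintype V] (p : V → Fin r) (hp : Function.Surjective p)
    (χ : (Fin r → V) → Fin (r + t))
    (hspan : SpanningColoring p χ)
    (hncov : ¬ CoveredByComponents p χ (t + 1))
    (u v : V) (huv : p u ≠ p v) :
    Set.ncard {c : Fin (r + t) | ¬ SameComp p χ c u v} ≤ t + 1 := by
  classical
  -- no part is contained in a single component
  have key : ∀ (c : Fin (r + t)) (j : Fin r), ∃ w, p w = j ∧ ¬ SameComp p χ c w u := by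
    intro c j
    by_contra! hcon
    apply hncov
    refine ⟨{(c, u)}, by simp, fun z => ⟨(c, u), by simp, ?_⟩⟩
    obtain ⟨e, he, hc, i, hi⟩ := hspan z c
    have h1 := sameComp_edge_aux (χ := χ) he i j
    rw [hc, hi] at h1
    exact Relation.ReflTransGen.trans h1 (hcon (e j) (he j))
  choose w hw hwn using key
  choose g hg using hp
  by_contra! hlt
  let A : Finset (Fin (r + t)) := Finset.univ.filter fun c => SameComp p χ c u v
  let J : Finset (Fin r) := (Finset.univ.erase (p u)).erase (p v)
  have hJ : J.card = r - 1 - 1 := by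
    rw [Finset.card_erase_of_mem (by simp [huv.symm]), Finset.card_erase_of_mem (by simp)]
    simp
  have hA : A.card + Set.ncard {c : Fin (r + t) | ¬ SameComp p χ c u v} = r + t := by
    have h2 := Finset.card_filter_add_card_filter_not (s := (Finset.univ : Finset (Fin (r + t))))
      (fun c => SameComp p χ c u v)
    have h3 : {c : Fin (r + t) | ¬ SameComp p χ c u v}
        = ((Finset.univ.filter fun c => ¬ SameComp p χ c u v : Finset (Fin (r + t))) :
          Set (Fin (r + t))) := by
      ext; simp
    rw [h3, Set.ncard_coe_finset]
    simpa using h2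
  have hle : Fintype.card A ≤ Fintype.card J := by
    simp only [Fintype.card_coe]
    omega
  obtain ⟨f⟩ := Function.Embedding.nonempty_of_card_le hle
  let e : Fin r → V := fun j =>
    if j = p u then u else if j = p v then v else
      if h : ∃ a : A, (f a : Fin r) = j then w h.choose j else g j
  have he : IsTransversal p e := by
    intro j
    simp only [e]
    split_ifs with h1 h2 h3
    · exact h1.symm
    · exact h2.symm
    · exact hw _ _
    · exact hg _
  have eu : e (p u) = u := by simp [e]
  have ev : e (p v) = v := by simp [e, huv.symm]
  have huvc := sameComp_edge_aux (χ := χ) he (p u) (p v)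
  rw [eu, ev] at huvc
  have hcA : χ e ∈ A := by simp [A, huvc]
  let a : A := ⟨χ e, hcA⟩
  have hfa := (f a).2
  simp only [J, Finset.mem_erase, Finset.mem_univ, and_true] at hfa
  have hex : ∃ b : A, (f b : Fin r) = f a := ⟨a, rfl⟩
  have hch : hex.choose = a := f.injective (Subtype.ext hex.choose_spec)
  have efa : e (f a) = w (χ e) (f a) := by
    have : e (f a) = w hex.choose (f a) := by
      simp only [e]
      rw [if_neg hfa.2, if_neg hfa.1, dif_pos hex]
    rw [this, hch]
  have hfin := sameComp_edge_aux (χ := χ) he (f a) (p u)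
  rw [eu, efa] at hfin
  exact hwn _ _ hfin
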